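/- Let a,b,c,d ≥ 0 satisfy a+c = 1, b+d = 2, ac = (1-b)² (Class II). Then W[a,b,c,d] is block-positive: for all vectors ψ, φ ∈ ℂ⁴ one has ⟨ψ⊗φ| W[a,b,c,d] |ψ⊗φ⟩ ≥ 0. -/

import Mathlib

open Complex Matrix ComplexOrder

/-- The entanglement witness `W[a,b,c,d]` on `ℂ⁴ ⊗ ℂ⁴`, identified with a
`16 × 16` complex matrix in the product basis `|i,j⟩`, indices mod 4. -/
noncomputable def W4 (a b c d : ℝ) :
    Matrix (Fin 4 × Fin 4) (Fin 4 × Fin 4) ℂ := fun p q =>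
  if p = q then
    (if p.2 = p.1 then (a : ℂ)
     else if p.2 = p.1 + 1 then (b : ℂ)
     else if p.2 = p.1 + 2 then (c : ℂ)
     else (d : ℂ))
  else if p.1 = p.2 ∧ q.1 = q.2 then -1 else 0

/-- The product vector `ψ ⊗ φ`. -/
def prodVec {α β : Type*} (ψ : α → ℂ) (φ : β → ℂ) : α × β → ℂ :=
  fun p => ψ p.1 * φ p.2

/-- The pairing `⟨v| X |v⟩`. -/
noncomputable def pairing {n : Type*} [Fintype n] (X : Matrix n n ℂ) (v : n → ℂ) : ℂ :=
  star v ⬝ᵥ X.mulVec v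

/-- The cyclic inequality that is equivalent, by Cauchy-Schwarz, to block-positivity of
`W4 a b c d` for Class II parameters. -/
theorem classII_sum_div_le_one {a b c d : ℝ}
    (ha : 0 ≤ a) (hb : 0 ≤ b) (hc : 0 ≤ c) (hd : 0 ≤ d)
    (h1 : a + c = 1) (h2 : b + d = 2) (h3 : a * c = (1 - b) ^ 2)
    {x₀ x₁ x₂ x₃ : ℝ} (h₀ : 0 < x₀) (h₁ : 0 < x₁) (h₂ : 0 < x₂) (h₃ : 0 < x₃) :
    x₀ / ((a + 1) * x₀ + d * x₁ + c * x₂ + b * x₃)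
      + x₁ / ((a + 1) * x₁ + d * x₂ + c * x₃ + b * x₀)
      + x₂ / ((a + 1) * x₂ + d * x₃ + c * x₀ + b * x₁)
      + x₃ / ((a + 1) * x₃ + d * x₀ + c * x₁ + b * x₂) ≤ 1 := by
  have hL₀ : 0 < (a + 1) * x₀ + d * x₁ + c * x₂ + b * x₃ := by positivity
  have hL₁ : 0 < (a + 1) * x₁ + d * x₂ + c * x₃ + b * x₀ := by positivity
  have hL₂ : 0 < (a + 1) * x₂ + d * x₃ + c * x₀ + b * x₁ := by positivity
  have hL₃ : 0 < (a + 1) * x₃ + d * x₀ + c * x₁ + b * x₂ := by positivity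
  obtain ⟨p, hp⟩ : ∃ p, p = (x₀ + x₂) / 2 := ⟨_, rfl⟩
  obtain ⟨u, hu⟩ : ∃ u, u = (x₀ - x₂) / 2 := ⟨_, rfl⟩
  obtain ⟨q, hq⟩ : ∃ q, q = (x₁ + x₃) / 2 := ⟨_, rfl⟩
  obtain ⟨v, hv⟩ : ∃ v, v = (x₁ - x₃) / 2 := ⟨_, rfl⟩
  obtain ⟨s, hs⟩ : ∃ s, s = 1 - b := ⟨_, rfl⟩
  obtain rfl : x₀ = p + u := by linarith
  obtain rfl : x₂ = p - u := by linarith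
  obtain rfl : x₁ = q + v := by linarith
  obtain rfl : x₃ = q - v := by linarith
  obtain rfl : b = 1 - s := by linarith
  obtain rfl : d = 1 + s := by linarith
  obtain rfl : c = 1 - a := by linarith
  have hsq : s ^ 2 = a * (1 - a) := by linarith
  obtain ⟨T, hT⟩ : ∃ T, T = p + q := ⟨_, rfl⟩
  obtain ⟨m, hm⟩ : ∃ m, m = a * u + s * v := ⟨_, rfl⟩
  obtain ⟨n, hn⟩ : ∃ n, n = a * v - s * u := ⟨_, rfl⟩
  have e₀ : (a + 1) * (p + u) + (1 + s) * (q + v) + (1 - a) * (p - u) + (1 - s) * (q - v)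
      = 2 * (T + m) := by subst hT hm; ring
  have e₁ : (a + 1) * (q + v) + (1 + s) * (p - u) + (1 - a) * (q - v) + (1 - s) * (p + u)
      = 2 * (T + n) := by subst hT hn; ring
  have e₂ : (a + 1) * (p - u) + (1 + s) * (q - v) + (1 - a) * (p + u) + (1 - s) * (q + v)
      = 2 * (T - m) := by subst hT hm; ring
  have e₃ : (a + 1) * (q - v) + (1 + s) * (p + u) + (1 - a) * (q + v) + (1 - s) * (p - u)
      = 2 * (T - n) := by subst hT hn; ring
  rw [e₀] at hL₀ ⊢
  rw [e₁] at hL₁ ⊢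
  rw [e₂] at hL₂ ⊢
  rw [e₃] at hL₃ ⊢
  have hTm : 0 < T + m := by linarith
  have hTn : 0 < T + n := by linarith
  have hTm' : 0 < T - m := by linarith
  have hTn' : 0 < T - n := by linarith
  have sum_pair : ∀ {P U M : ℝ}, 0 < T + M → 0 < T - M →
      (P + U) / (2 * (T + M)) + (P - U) / (2 * (T - M)) = (P * T - U * M) / (T ^ 2 - M ^ 2) := by
    intro P U M h h'
    rw [show T ^ 2 - M ^ 2 = (T + M) * (T - M) by ring]
    field_simp
    ring
  have hDm : 0 < T ^ 2 - m ^ 2 := by nlinarith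
  have hDn : 0 < T ^ 2 - n ^ 2 := by nlinarith
  have mul_le_of_abs : ∀ {P U M : ℝ}, 0 < P + U → 0 < P - U → 0 < T + M → 0 < T - M →
      U * M ≤ P * T := by
    intro P U M k₁ k₂ k₃ k₄
    nlinarith [mul_pos k₁ k₄, mul_pos k₂ k₃]
  have hum : u * m ≤ p * T := mul_le_of_abs h₀ h₂ hTm hTm'
  have hvn : v * n ≤ q * T := mul_le_of_abs h₁ h₃ hTn hTn'
  have hrot : u * m + v * n = m ^ 2 + n ^ 2 := by
    subst hm hn
    linear_combination -(u ^ 2 + v ^ 2) * hsq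
  calc _ = (p * T - u * m) / (T ^ 2 - m ^ 2) + (q * T - v * n) / (T ^ 2 - n ^ 2) := by
        rw [← sum_pair hTm hTm', ← sum_pair hTn hTn']; ring
    _ ≤ 1 := by
        rw [div_add_div _ _ hDm.ne' hDn.ne', div_le_one (mul_pos hDm hDn)]
        have key : (T ^ 2 - m ^ 2) * (T ^ 2 - n ^ 2)
            - ((p * T - u * m) * (T ^ 2 - n ^ 2) + (T ^ 2 - m ^ 2) * (q * T - v * n))
            = (p * T - u * m) * n ^ 2 + (q * T - v * n) * m ^ 2 + m ^ 2 * n ^ 2 := by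
          subst hT
          linear_combination (p + q) ^ 2 * hrot
        have : 0 ≤ (p * T - u * m) * n ^ 2 := mul_nonneg (by linarith) (sq_nonneg n)
        have : 0 ≤ (q * T - v * n) * m ^ 2 := mul_nonneg (by linarith) (sq_nonneg m)
        nlinarith [mul_nonneg (sq_nonneg m) (sq_nonneg n)]

/-- The quartic form bounding the pairing of `W4 a b c d` with `ψ ⊗ φ` from below,
in terms of the moduli `r` of `ψ` and `t` of `φ`. -/
def modulusForm (a b c d : ℝ) (r t : Fin 4 → ℝ) : ℝ :=
  ∑ i, ((a + 1) * r i ^ 2 + d * r (i + 1) ^ 2 + c * r (i + 2) ^ 2 + b * r (i + 3) ^ 2) * t i ^ 2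
    - (∑ i, r i * t i) ^ 2

theorem modulusForm_nonneg_of_pos {a b c d : ℝ}
    (ha : 0 ≤ a) (hb : 0 ≤ b) (hc : 0 ≤ c) (hd : 0 ≤ d)
    (h1 : a + c = 1) (h2 : b + d = 2) (h3 : a * c = (1 - b) ^ 2)
    {r : Fin 4 → ℝ} (hr : ∀ i, 0 < r i) (t : Fin 4 → ℝ) : 0 ≤ modulusForm a b c d r t := by
  set L : Fin 4 → ℝ := fun i =>
    (a + 1) * r i ^ 2 + d * r (i + 1) ^ 2 + c * r (i + 2) ^ 2 + b * r (i + 3) ^ 2 with hL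
  have hLpos : ∀ i, 0 < L i := fun i => by
    have := hr i
    simp only [hL]
    positivity
  have hsum : ∑ i, r i ^ 2 / L i ≤ 1 := by
    rw [Fin.sum_univ_four]
    exact classII_sum_div_le_one ha hb hc hd h1 h2 h3
      (pow_pos (hr 0) 2) (pow_pos (hr 1) 2) (pow_pos (hr 2) 2) (pow_pos (hr 3) 2)
  have hnn : 0 ≤ ∑ i, L i * t i ^ 2 :=
    Finset.sum_nonneg fun i _ => mul_nonneg (hLpos i).le (sq_nonneg _)
  have hcs : (∑ i, r i * t i) ^ 2 ≤ (∑ i, r i ^ 2 / L i) * ∑ i, L i * t i ^ 2 := by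
    refine Finset.sum_sq_le_sum_mul_sum_of_sq_le_mul _
      (fun i _ => div_nonneg (sq_nonneg _) (hLpos i).le)
      (fun i _ => mul_nonneg (hLpos i).le (sq_nonneg _)) fun i _ => le_of_eq ?_
    have := (hLpos i).ne'
    field_simp
  exact sub_nonneg.2 (hcs.trans (mul_le_of_le_one_left hnn hsum))

theorem modulusForm_nonneg {a b c d : ℝ}
    (ha : 0 ≤ a) (hb : 0 ≤ b) (hc : 0 ≤ c) (hd : 0 ≤ d)
    (h1 : a + c = 1) (h2 : b + d = 2) (h3 : a * c = (1 - b) ^ 2)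
    {r : Fin 4 → ℝ} (hr : ∀ i, 0 ≤ r i) (t : Fin 4 → ℝ) : 0 ≤ modulusForm a b c d r t := by
  have hcont : Continuous fun ε : ℝ => modulusForm a b c d (fun i => r i + ε) t := by
    unfold modulusForm
    fun_prop
  have hlim : Filter.Tendsto (fun ε : ℝ => modulusForm a b c d (fun i => r i + ε) t)
      (nhdsWithin 0 (Set.Ioi 0)) (nhds (modulusForm a b c d r t)) := by
    simpa using (hcont.tendsto 0).mono_left nhdsWithin_le_nhds
  refine ge_of_tendsto hlim ?_
  filter_upwards [self_mem_nhdsWithin] with ε hε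
  exact modulusForm_nonneg_of_pos ha hb hc hd h1 h2 h3
    (fun i => add_pos_of_nonneg_of_pos (hr i) hε) t

theorem pairing_W4_prodVec (a b c d : ℝ) (ψ φ : Fin 4 → ℂ) :
    pairing (W4 a b c d) (prodVec ψ φ) =
      ((modulusForm a b c d (fun i => ‖ψ i‖) (fun i => ‖φ i‖)
        + ((∑ i, ‖ψ i‖ * ‖φ i‖) ^ 2 - ‖∑ i, ψ i * φ i‖ ^ 2) : ℝ) : ℂ) := by
  have hform : modulusForm a b c d (fun i => ‖ψ i‖) (fun i => ‖φ i‖)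
        + ((∑ i, ‖ψ i‖ * ‖φ i‖) ^ 2 - ‖∑ i, ψ i * φ i‖ ^ 2) =
      ∑ i, ((a + 1) * ‖ψ i‖ ^ 2 + d * ‖ψ (i + 1)‖ ^ 2 + c * ‖ψ (i + 2)‖ ^ 2
        + b * ‖ψ (i + 3)‖ ^ 2) * ‖φ i‖ ^ 2 - ‖∑ i, ψ i * φ i‖ ^ 2 := by
    unfold modulusForm
    ring
  rw [hform]
  push_cast
  simp only [← Complex.conj_mul']
  simp [pairing, prodVec, W4, dotProduct, Matrix.mulVec, Fintype.sum_prod_type, Fin.sum_univ_four,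
    Prod.ext_iff]
  ring

/-- for Class II parameters, `W[a,b,c,d]` is block-positive. -/
theorem W4_classII_blockPositive (a b c d : ℝ)
    (ha : 0 ≤ a) (hb : 0 ≤ b) (hc : 0 ≤ c) (hd : 0 ≤ d)
    (h1 : a + c = 1) (h2 : b + d = 2) (h3 : a * c = (1 - b) ^ 2) :
    ∀ ψ φ : Fin 4 → ℂ, 0 ≤ pairing (W4 a b c d) (prodVec ψ φ) := by
  intro ψ φ
  rw [pairing_W4_prodVec, Complex.zero_le_real]
  have hform := modulusForm_nonneg ha hb hc hd h1 h2 h3 (fun i => norm_nonneg (ψ i))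
    (fun i => ‖φ i‖)
  have hnorm : ‖∑ i, ψ i * φ i‖ ≤ ∑ i, ‖ψ i‖ * ‖φ i‖ :=
    (norm_sum_le _ _).trans_eq (by simp only [norm_mul])
  exact add_nonneg hform (sub_nonneg.2 (pow_le_pow_left₀ (norm_nonneg _) hnorm 2))
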